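/- Let C ⊆ F2^72 be a binary self-dual doubly-even linear code with minimum nonzero weight 16, and let g ∈ S_72 be the permutation that cyclically permutes each of the ten blocks {7k+1,…,7k+7} for k = 0,…,9 (a product of ten disjoint 7-cycles) and fixes the coordinates 71 and 72. Assume g ∈ Aut(C). Define D0 := {a ∈ F2^10 : r7(a) ∈ C}, where r7(a) ∈ F2^72 is the vector whose entry at position 7k+j (k = 0,…,9, j = 1,…,7) equals a_{k+1} and whose entries at positions 71 and 72 are 0. Then there is a permutation π ∈ S_10 such that {a∘π : a ∈ D0} = E, where E := {(b_1,b_1,b_2,b_2,b_3,b_3,b_4,b_4,b_5,b_5) : b ∈ F2^5, b_1+b_2+b_3+b_4+b_5 = 0} is the maximal doubly-even subcode of the 2-fold repetition code F2^5 ⊗ ⟨(1,1)⟩. -/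

import Mathlib

/-- The Hamming weight of a binary vector: the number of nonzero coordinates. -/
def wt {n : ℕ} (c : Fin n → ZMod 2) : ℕ := (Finset.univ.filter fun i => c i ≠ 0).card

/-- The standard inner product on `F2^n`. -/
def inner2 {n : ℕ} (v w : Fin n → ZMod 2) : ZMod 2 := ∑ i, v i * w i

/-- A binary code is self-dual if it equals its dual with respect to the
standard inner product. -/
def IsSelfDual {n : ℕ} (C : Submodule (ZMod 2) (Fin n → ZMod 2)) : Prop :=
  (C : Set (Fin n → ZMod 2)) = {v | ∀ c ∈ C, inner2 v c = 0}

/-- A binary code is doubly even if every codeword has weight divisible by 4. -/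
def IsDoublyEven {n : ℕ} (C : Submodule (ZMod 2) (Fin n → ZMod 2)) : Prop :=
  ∀ c ∈ C, 4 ∣ wt c

/-- The permutation of `{1,…,72}` that cyclically permutes each of the ten
blocks `{7k+1,…,7k+7}` (`k = 0,…,9`) and fixes the coordinates 71 and 72,
written 0-indexed on `Fin 72`: a product of ten disjoint 7-cycles. -/
def g7 : Equiv.Perm (Fin 72) where
  toFun i := if h : i.val < 70 then
      ⟨7 * (i.val / 7) + ((i.val % 7 + 1) % 7), by omega⟩ else i
  invFun i := if h : i.val < 70 then
      ⟨7 * (i.val / 7) + ((i.val % 7 + 6) % 7), by omega⟩ else i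
  left_inv := by decide
  right_inv := by decide

/-- The 7-fold repetition map `F2^10 → F2^72`: the entry of `r7 a` at position
`7k+j` (`k = 0,…,9`, `j = 1,…,7`) equals `a_{k+1}`, and the entries at the two
fixed positions 71 and 72 are `0`. -/
def r7 : (Fin 10 → ZMod 2) →ₗ[ZMod 2] (Fin 72 → ZMod 2) where
  toFun a := fun i => if h : i.val < 70 then a ⟨i.val / 7, by omega⟩ else 0
  map_add' := by intro a b; funext i; by_cases h : i.val < 70 <;> simp [h]
  map_smul' := by intro m a; funext i; by_cases h : i.val < 70 <;> simp [h]

/-- The maximal doubly-even subcode of the 2-fold repetition code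
`F2^5 ⊗ ⟨(1,1)⟩ ⊆ F2^10`, as a set:
all vectors `(b₁,b₁,b₂,b₂,…,b₅,b₅)` with `b₁+⋯+b₅ = 0`. -/
def Ecode : Set (Fin 10 → ZMod 2) :=
  {a | ∃ b : Fin 5 → ZMod 2, (∑ j, b j = 0) ∧
    ∀ i : Fin 10, a i = b ⟨i.val / 2, by have := i.isLt; omega⟩}

/-- The space `F2^10 × F2 × F2` of block-constant vectors. -/
abbrev MM : Type := (Fin 10 → ZMod 2) × ZMod 2 × ZMod 2

/-- The repetition map including the two fixed coordinates. -/
def RR : MM →ₗ[ZMod 2] (Fin 72 → ZMod 2) where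
  toFun m := fun i => if h : i.val < 70 then m.1 ⟨i.val / 7, by omega⟩ else
    if i.val = 70 then m.2.1 else m.2.2
  map_add' := by
    intro a b; funext i
    by_cases h : i.val < 70
    · simp [h]
    · by_cases h' : i.val = 70 <;> simp [h, h']
  map_smul' := by
    intro c a; funext i
    by_cases h : i.val < 70
    · simp [h]
    · by_cases h' : i.val = 70 <;> simp [h, h']

/-- The coordinate `7k+j`. -/
def ix (k : Fin 10) (j : Fin 7) : Fin 72 := ⟨7 * k.val + j.val, by omega⟩

lemma sum72 {A : Type*} [AddCommMonoid A] (f : Fin 72 → A) :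
    ∑ i, f i = (∑ k : Fin 10, ∑ j : Fin 7, f (ix k j)) + f 70 + f 71 := by
  rw [Fin.sum_univ_castSucc, Fin.sum_univ_castSucc]
  congr 2
  rw [← Fintype.sum_prod_type' (f := fun k j => f (ix k j))]
  symm
  apply Fintype.sum_equiv (finProdFinEquiv (m := 10) (n := 7))
  intro x
  congr 1
  apply Fin.ext
  simp [ix, finProdFinEquiv]
  omega

lemma RR_ix (m : MM) (k : Fin 10) (j : Fin 7) : RR m (ix k j) = m.1 k := by
  have h : (ix k j).val < 70 := by simp only [ix]; omega
  have h2 : (ix k j).val / 7 = k.val := by simp only [ix]; omega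
  simp only [RR, LinearMap.coe_mk, AddHom.coe_mk, h, dif_pos]
  exact congrArg m.1 (Fin.ext h2)

lemma RR_70 (m : MM) : RR m 70 = m.2.1 := by simp [RR]
lemma RR_71 (m : MM) : RR m 71 = m.2.2 := by simp [RR]

lemma wt_sum {n : ℕ} (c : Fin n → ZMod 2) : wt c = ∑ i, (c i).val := by
  unfold wt
  rw [Finset.card_filter]
  apply Finset.sum_congr rfl
  intro i _
  generalize c i = z
  revert z; decide

lemma wt_RR (m : MM) : wt (RR m) = 7 * wt m.1 + m.2.1.val + m.2.2.val := by
  rw [wt_sum, sum72, RR_70, RR_71, wt_sum, Finset.mul_sum]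
  simp [RR_ix]

/-- The inner product on `MM`. -/
def ip (m m' : MM) : ZMod 2 := inner2 m.1 m'.1 + m.2.1 * m'.2.1 + m.2.2 * m'.2.2

/-- The block-sum map. -/
def avg (c : Fin 72 → ZMod 2) : MM := (fun k => ∑ j : Fin 7, c (ix k j), c 70, c 71)

lemma inner_RR (m : MM) (c : Fin 72 → ZMod 2) : inner2 (RR m) c = ip m (avg c) := by
  unfold inner2 ip
  rw [sum72, RR_70, RR_71]
  simp only [RR_ix, avg, inner2, Finset.mul_sum]

lemma g7_ix (k : Fin 10) (j : Fin 7) : g7 (ix k j) = ix k (j + 1) := by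
  revert k j; decide

lemma ext72 {c d : Fin 72 → ZMod 2} (h : ∀ k j, c (ix k j) = d (ix k j)) (h70 : c 70 = d 70)
    (h71 : c 71 = d 71) : c = d := by
  funext i
  by_cases hi : i.val < 70
  · have := h ⟨i.val / 7, by omega⟩ ⟨i.val % 7, by omega⟩
    have e : ix ⟨i.val / 7, by omega⟩ ⟨i.val % 7, by omega⟩ = i := by
      apply Fin.ext; simp only [ix]; omega
    rwa [e] at this
  · by_cases h' : i.val = 70
    · have : i = 70 := Fin.ext h'
      rw [this]; exact h70
    · have : i = 71 := Fin.ext (by have := i.isLt; change i.val = 71; omega)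
      rw [this]; exact h71

lemma avg_mem (C : Submodule (ZMod 2) (Fin 72 → ZMod 2))
    (hg : ∀ c ∈ C, c ∘ ⇑g7 ∈ C) (c : Fin 72 → ZMod 2) (hc : c ∈ C) : RR (avg c) ∈ C := by
  have e : RR (avg c) = c + c ∘ g7 + c ∘ g7 ∘ g7 + c ∘ g7 ∘ g7 ∘ g7 + c ∘ g7 ∘ g7 ∘ g7 ∘ g7
      + c ∘ g7 ∘ g7 ∘ g7 ∘ g7 ∘ g7 + c ∘ g7 ∘ g7 ∘ g7 ∘ g7 ∘ g7 ∘ g7 := by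
    have h7 : ∀ z : ZMod 2, z = z + z + z + z + z + z + z := by decide
    apply ext72
    · intro k j
      rw [RR_ix]
      simp only [avg, Pi.add_apply, Function.comp_apply, g7_ix]
      rw [Fin.sum_univ_seven]
      fin_cases j <;> simp <;> abel
    · rw [RR_70]
      have : g7 70 = 70 := by decide
      simp only [avg, Pi.add_apply, Function.comp_apply, this]
      exact h7 _
    · rw [RR_71]
      have : g7 71 = 71 := by decide
      simp only [avg, Pi.add_apply, Function.comp_apply, this]
      exact h7 _
  rw [e]
  have h1 := hg _ hc
  have h2 := hg _ h1
  have h3 := hg _ h2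
  have h4 := hg _ h3
  have h5 := hg _ h4
  have h6 := hg _ h5
  exact C.add_mem (C.add_mem (C.add_mem (C.add_mem (C.add_mem (C.add_mem hc h1) h2) h3) h4) h5) h6

lemma wt_pair (i j : Fin 10) (h : i ≠ j) (α : ZMod 2) :
    wt (Pi.single j 1 + α • Pi.single i 1 : Fin 10 → ZMod 2) = 1 + α.val := by
  revert i j α; decide

/-- The pair vectors. -/
def pr (i j : Fin 10) : MM := (Pi.single i 1 + Pi.single j 1, 1, 1)

lemma inner_single (j : Fin 10) (x : Fin 10 → ZMod 2) : inner2 (Pi.single j 1) x = x j := by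
  simp [inner2, Pi.single_apply]

lemma inner_comb (i j : Fin 10) (α : ZMod 2) (x : Fin 10 → ZMod 2) :
    inner2 (Pi.single j 1 + α • Pi.single i 1) x = x j + α * x i := by
  simp [inner2, Pi.single_apply, add_mul, Finset.sum_add_distrib]

section core
variable (D : Submodule (ZMod 2) MM) (hsd : ∀ m, (∀ x ∈ D, ip m x = 0) → m ∈ D)
  (hde : ∀ m ∈ D, 4 ∣ 7 * wt m.1 + m.2.1.val + m.2.2.val)
  (hmin : ∀ m ∈ D, m ≠ 0 → 16 ≤ 7 * wt m.1 + m.2.1.val + m.2.2.val)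

include hsd hmin in
lemma exists_y (i j : Fin 10) (hij : i ≠ j) (hno : pr i j ∉ D) :
    ∃ y ∈ D, y.1 i = 0 ∧ y.2.1 = 0 ∧ y.2.2 = 0 ∧ y.1 j = 1 := by
  by_contra hcon
  push Not at hcon
  let fi : Fin 10 → (D →ₗ[ZMod 2] ZMod 2) := fun i =>
    (LinearMap.proj i ∘ₗ LinearMap.fst (ZMod 2) _ _) ∘ₗ D.subtype
  let fs : D →ₗ[ZMod 2] ZMod 2 :=
    (LinearMap.fst (ZMod 2) _ _ ∘ₗ LinearMap.snd (ZMod 2) (Fin 10 → ZMod 2) _) ∘ₗ D.subtype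
  let ft : D →ₗ[ZMod 2] ZMod 2 :=
    (LinearMap.snd (ZMod 2) _ _ ∘ₗ LinearMap.snd (ZMod 2) (Fin 10 → ZMod 2) _) ∘ₗ D.subtype
  have hspan : fi j ∈ Submodule.span (ZMod 2) (Set.range ![fi i, fs, ft]) := by
    apply mem_span_of_iInf_ker_le_ker
    intro x hx
    simp only [Submodule.mem_iInf, LinearMap.mem_ker] at hx ⊢
    have h0 := hx 0
    have h1 := hx 1
    have h2 := hx 2
    have := hcon x.1 x.2 h0 h1 h2
    have h2 : ∀ z : ZMod 2, z ≠ 1 → z = 0 := by decide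
    exact h2 _ this
  rw [Submodule.mem_span_range_iff_exists_fun] at hspan
  obtain ⟨c, hc⟩ := hspan
  have hu : ((Pi.single j 1 + c 0 • Pi.single i 1, c 1, c 2) : MM) ∈ D := by
    apply hsd
    intro x hx
    have := LinearMap.congr_fun hc ⟨x, hx⟩
    simp [Fin.sum_univ_three, fi, fs, ft] at this
    simp only [ip, inner_comb]
    rw [← this]
    have : ∀ a b c : ZMod 2, a + b + c + a + b + c = 0 := by decide
    exact this _ _ _
  have hne : ((Pi.single j 1 + c 0 • Pi.single i 1, c 1, c 2) : MM) ≠ 0 := by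
    intro h
    have := congrFun (congrArg Prod.fst h) j
    simp [Pi.single_apply, hij.symm] at this
  have hw := hmin _ hu hne
  simp only [wt_pair i j hij] at hw
  have h0 := ZMod.val_lt (c 0)
  have h1 := ZMod.val_lt (c 1)
  have h2 := ZMod.val_lt (c 2)
  have key : ∀ z : ZMod 2, z.val = 1 → z = 1 := by decide
  have k0 := key (c 0) (by omega)
  have k1 := key (c 1) (by omega)
  have k2 := key (c 2) (by omega)
  rw [k0, k1, k2, one_smul, add_comm] at hu
  exact hno hu

lemma wt_cast {n : ℕ} (x : Fin n → ZMod 2) : ((wt x : ℕ) : ZMod 2) = ∑ i, x i := by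
  rw [wt_sum]; push_cast; simp

include hsd hde in
lemma allone_mem : ((fun _ => 1, 1, 1) : MM) ∈ D := by
  apply hsd
  intro x hx
  have h := hde x hx
  have h2 : ((7 * wt x.1 + x.2.1.val + x.2.2.val : ℕ) : ZMod 2) = 0 := by
    rw [ZMod.natCast_eq_zero_iff]; omega
  push_cast at h2
  rw [wt_cast] at h2
  simp only [ip, inner2, one_mul]
  simp only [ZMod.natCast_val, ZMod.cast_id', id_eq] at h2
  have : (7 : ZMod 2) = 1 := by decide
  rwa [this, one_mul] at h2

/-- The sign character. -/
def chi (z : ZMod 2) : ℤ := 1 - 2 * z.val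

lemma wt_two (x : Fin 10 → ZMod 2) (i : Fin 10) (hi : x i = 1) (h : wt x = 2) :
    ∃ j, i ≠ j ∧ x = Pi.single i 1 + Pi.single j 1 := by
  unfold wt at h
  obtain ⟨p, q, hpq, hs⟩ := Finset.card_eq_two.mp h
  have hmem : ∀ k, x k ≠ 0 ↔ k = p ∨ k = q := by
    intro k
    have := Finset.ext_iff.mp hs k
    simpa using this
  have key : ∀ z : ZMod 2, z ≠ 0 → z = 1 := by decide
  have hx : x = Pi.single p 1 + Pi.single q 1 := by
    funext k
    by_cases hk : k = p
    · subst hk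
      simp [key _ ((hmem k).2 (Or.inl rfl)), Pi.single_apply, hpq]
    · by_cases hk' : k = q
      · subst hk'
        simp [key _ ((hmem k).2 (Or.inr rfl)), Pi.single_apply, hk]
      · have : x k = 0 := by
          by_contra h0
          rcases (hmem k).1 h0 with h | h
          · exact hk h
          · exact hk' h
        simp [this, Pi.single_apply, hk, hk']
  rcases (hmem i).1 (by rw [hi]; decide) with h | h
  · exact ⟨q, by rw [h]; exact hpq, by rw [h]; exact hx⟩
  · exact ⟨p, by rw [h]; exact hpq.symm, by rw [h, add_comm]; exact hx⟩

set_option linter.constructorNameAsVariable false in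
include hsd hde hmin in
lemma exists_pair (i : Fin 10) : ∃ j, i ≠ j ∧ pr i j ∈ D := by
  classical
  by_contra hcon
  push Not at hcon
  let S : Finset MM := Finset.univ.filter fun x => x ∈ D ∧ x.1 i = 1 ∧ x.2.1 = 1 ∧ x.2.2 = 1
  have hbal : ∀ j, i ≠ j → ∑ x ∈ S, chi (x.1 j) = 0 := by
    intro j hij
    obtain ⟨y, hy, h1, h2, h3, h4⟩ := exists_y D hsd hmin i j hij (hcon j hij)
    have hchi : ∀ z : ZMod 2, chi z + chi (z + 1) = 0 := by decide
    have hz1 : ∀ z : ZMod 2, z + 1 ≠ z := by decide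
    apply Finset.sum_involution (fun x _ => x + y)
    · intro x hx
      simpa [h4] using hchi (x.1 j)
    · intro x hx _ he
      have := congrFun (congrArg Prod.fst he) j
      simp [h4] at this
    · intro x hx
      simp only [S, Finset.mem_filter, Finset.mem_univ, true_and] at hx ⊢
      refine ⟨D.add_mem hx.1 hy, ?_⟩
      simp [h1, h2, h3, hx]
    · intro x hx
      rw [add_assoc]
      have : y + y = 0 := CharTwo.add_self_eq_zero y
      rw [this, add_zero]
  have htot : ∑ x ∈ S, ∑ j ∈ Finset.univ.erase i, chi (x.1 j) = 0 := by
    rw [Finset.sum_comm]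
    apply Finset.sum_eq_zero
    intro j hj
    exact hbal j (Finset.ne_of_mem_erase hj).symm
  have hneg : ∑ x ∈ S, ∑ j ∈ Finset.univ.erase i, chi (x.1 j) < 0 := by
    apply Finset.sum_neg
    · intro x hx
      simp only [S, Finset.mem_filter, Finset.mem_univ, true_and] at hx
      obtain ⟨hxD, hxi, hs, ht⟩ := hx
      have hd := hde x hxD
      rw [hs, ht] at hd
      have hv : (1 : ZMod 2).val = 1 := rfl
      rw [hv] at hd
      have hw2 : wt x.1 ≠ 2 := by
        intro h2
        obtain ⟨j, hij, hx⟩ := wt_two x.1 i hxi h2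
        apply hcon j hij
        have : x = pr i j := by
          unfold pr; ext1
          · exact hx
          · ext1
            · exact hs
            · exact ht
        rwa [← this]
      have hsum : ∑ j, chi (x.1 j) = 10 - 2 * (wt x.1 : ℤ) := by
        rw [wt_sum]
        simp [chi, Finset.sum_sub_distrib, Finset.mul_sum]
      rw [← Finset.add_sum_erase _ _ (Finset.mem_univ i), hxi] at hsum
      have : chi 1 = -1 := by decide
      rw [this] at hsum
      omega
    · refine ⟨(fun _ => 1, 1, 1), ?_⟩
      simp only [S, Finset.mem_filter, Finset.mem_univ, true_and, and_true]
      exact allone_mem D hsd hde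
  omega

include hmin in
lemma pair_unique (i j k : Fin 10) (hj : pr i j ∈ D) (hk : pr i k ∈ D) : j = k := by
  by_contra hjk
  have h := D.add_mem hj hk
  have e : pr i j + pr i k = (Pi.single k 1 + (1 : ZMod 2) • Pi.single j 1, 0, 0) := by
    unfold pr
    ext1
    · funext l
      have : ∀ a b c : ZMod 2, a + b + (a + c) = c + 1 * b := by decide
      exact this _ _ _
    · rfl
  rw [e] at h
  have hne : ((Pi.single k 1 + (1 : ZMod 2) • Pi.single j 1, 0, 0) : MM) ≠ 0 := by
    intro h
    have := congrFun (congrArg Prod.fst h) j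
    simp [Pi.single_apply, hjk] at this
  have := hmin _ h hne
  simp only [wt_pair j k hjk] at this
  have hv : (1 : ZMod 2).val = 1 := rfl
  have hv0 : (0 : ZMod 2).val = 0 := rfl
  omega

/-- The standard fixed-point-free involution. -/
def tau : Equiv.Perm (Fin 10) where
  toFun i := ⟨2 * (i.val / 2) + (i.val + 1) % 2, by omega⟩
  invFun i := ⟨2 * (i.val / 2) + (i.val + 1) % 2, by omega⟩
  left_inv := by decide
  right_inv := by decide

lemma cyc (s : Equiv.Perm (Fin 10)) (h1 : ∀ i, s (s i) = i) (h2 : ∀ i, s i ≠ i) :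
    s.cycleType = Multiset.replicate 5 2 := by
  have ho : orderOf s = 2 := by
    apply orderOf_eq_prime
    · ext i; simp [pow_two, h1]
    · intro h; exact h2 0 (by rw [h]; rfl)
  obtain ⟨n, hn⟩ := Equiv.Perm.cycleType_prime_order (σ := s) (by rw [ho]; exact Nat.prime_two)
  have hs := Equiv.Perm.sum_cycleType s
  have hsup : s.support = Finset.univ := by
    ext i; simp [h2]
  rw [hsup, hn, ho] at hs
  simp at hs
  have : n = 4 := by omega
  rw [hn, ho, this]

include hsd hde hmin in
lemma exists_perm : ∃ π : Equiv.Perm (Fin 10), ∀ i, pr (π i) (π (tau i)) ∈ D := by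
  choose f hf hfD using exists_pair D hsd hde hmin
  have hsymm : ∀ i j, pr i j = pr j i := fun i j => by unfold pr; rw [add_comm]
  have hinv : Function.Involutive f := by
    intro i
    have := hfD i
    rw [hsymm] at this
    exact pair_unique D hmin _ _ _ (hfD (f i)) this
  have hc : IsConj tau (hinv.toPerm f) := by
    rw [Equiv.Perm.isConj_iff_cycleType_eq, cyc tau (by decide) (by decide),
      cyc (hinv.toPerm f) hinv (fun i => (hf i).symm)]
  obtain ⟨π, hπ⟩ := isConj_iff.mp hc
  refine ⟨π, fun i => ?_⟩
  have : π (tau i) = f (π i) := by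
    have := congrArg (fun s : Equiv.Perm (Fin 10) => s (π i)) hπ
    simpa using this
  rw [this]
  exact hfD _

end core

lemma wt_comp (a : Fin 10 → ZMod 2) (π : Equiv.Perm (Fin 10)) : wt (a ∘ π) = wt a := by
  rw [wt_sum, wt_sum]
  exact Equiv.sum_comp π (fun i => (a i).val)

lemma r7_eq (a : Fin 10 → ZMod 2) : r7 a = RR (a, 0, 0) := by
  funext i
  simp [r7, RR]

lemma coef (i : Fin 10) (x : Fin 5) :
    ((if i = ⟨2 * x.val, by omega⟩ then (1 : ZMod 2) else 0) +
      if i = tau ⟨2 * x.val, by omega⟩ then 1 else 0) =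
    if x = ⟨i.val / 2, by omega⟩ then 1 else 0 := by
  revert i x; decide

/-- For an extremal self-dual doubly-even `[72,36,16]` code invariant under the
permutation `g7` of order 7 (ten 7-cycles and two fixed points), the shortened
fixed code `D0 = {a ∈ F2^10 : r7 a ∈ C}` is permutation-equivalent to the
maximal doubly-even subcode of the 2-fold repetition code `F2^5 ⊗ ⟨(1,1)⟩`. -/
theorem fixed_code_of_order_seven (C : Submodule (ZMod 2) (Fin 72 → ZMod 2))
    (hsd : IsSelfDual C)
    (hde : IsDoublyEven C)
    (hmin : ∀ c ∈ C, c ≠ 0 → 16 ≤ wt c)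
    (hex : ∃ c ∈ C, wt c = 16)
    (hg : (fun c => c ∘ ⇑g7) '' (C : Set (Fin 72 → ZMod 2)) = C) :
    ∃ π : Equiv.Perm (Fin 10),
      (fun a => a ∘ ⇑π) '' (C.comap r7 : Set (Fin 10 → ZMod 2)) = Ecode := by
  have hg' : ∀ c ∈ C, c ∘ ⇑g7 ∈ C := by
    intro c hc
    have : c ∘ ⇑g7 ∈ (fun c => c ∘ ⇑g7) '' (C : Set (Fin 72 → ZMod 2)) := ⟨c, hc, rfl⟩
    rw [hg] at this
    exact this
  have hC : ∀ v, v ∈ C ↔ ∀ c ∈ C, inner2 v c = 0 := fun v => Set.ext_iff.mp hsd v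
  let D : Submodule (ZMod 2) MM := C.comap RR
  have hD1 : ∀ m, (∀ x ∈ D, ip m x = 0) → m ∈ D := by
    intro m hm
    change RR m ∈ C
    rw [hC]
    intro c hc
    rw [inner_RR]
    exact hm _ (avg_mem C hg' c hc)
  have hD0 : ∀ m ∈ D, ∀ x ∈ D, ip m x = 0 := by
    intro m hm x hx
    have h := (hC _).1 hm _ hx
    rw [inner_RR] at h
    have e : avg (RR x) = x := by
      unfold avg
      ext1
      · funext k
        have h7 : ∀ z : ZMod 2, z + z + z + z + z + z + z = z := by decide
        simp only [RR_ix, Fin.sum_univ_seven, h7]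
      · ext1
        · exact RR_70 x
        · exact RR_71 x
    rwa [e] at h
  have hD2 : ∀ m ∈ D, 4 ∣ 7 * wt m.1 + m.2.1.val + m.2.2.val := by
    intro m hm
    rw [← wt_RR]; exact hde _ hm
  have hD3 : ∀ m ∈ D, m ≠ 0 → 16 ≤ 7 * wt m.1 + m.2.1.val + m.2.2.val := by
    intro m hm hne
    rw [← wt_RR]
    apply hmin _ hm
    intro h0
    apply hne
    ext1
    · funext k
      rw [← RR_ix m k 0, h0]; rfl
    · ext1
      · rw [← RR_70, h0]; rfl
      · rw [← RR_71, h0]; rfl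
  obtain ⟨π, hπ⟩ := exists_perm D hD1 hD2 hD3
  refine ⟨π, ?_⟩
  ext v
  constructor
  · rintro ⟨a, ha, rfl⟩
    have haD : ((a, 0, 0) : MM) ∈ D := by
      change RR _ ∈ C
      rw [← r7_eq]; exact ha
    have heq : ∀ i, a (π i) = a (π (tau i)) := by
      intro i
      have h := hD0 _ (hπ i) _ haD
      have e : ∀ x y : ZMod 2, x + 1 * y = 0 → y = x := by decide
      apply e
      rw [← inner_comb (π i) (π (tau i)) 1 a, one_smul, add_comm]
      simpa [ip, pr] using h
    have hw := hD2 _ haD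
    simp only [ZMod.val_zero, add_zero] at hw
    rw [← wt_comp a π] at hw
    have e0 := heq 0
    have e2 := heq 2
    have e4 := heq 4
    have e6 := heq 6
    have e8 := heq 8
    have t0 : tau 0 = 1 := by decide
    have t2 : tau 2 = 3 := by decide
    have t4 : tau 4 = 5 := by decide
    have t6 : tau 6 = 7 := by decide
    have t8 : tau 8 = 9 := by decide
    rw [t0] at e0
    rw [t2] at e2
    rw [t4] at e4
    rw [t6] at e6
    rw [t8] at e8
    refine ⟨fun j => a (π ⟨2 * j.val, by omega⟩), ?_, ?_⟩
    · rw [← wt_cast, ZMod.natCast_eq_zero_iff]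
      have : wt (a ∘ π) = 2 * wt (fun j : Fin 5 => a (π ⟨2 * j.val, by omega⟩)) := by
        rw [wt_sum, wt_sum, Fin.sum_univ_five, Fin.sum_univ_succ, Fin.sum_univ_succ,
          Fin.sum_univ_eight]
        change (a (π 0)).val + ((a (π 1)).val + ((a (π 2)).val + (a (π 3)).val + (a (π 4)).val +
          (a (π 5)).val + (a (π 6)).val + (a (π 7)).val + (a (π 8)).val + (a (π 9)).val)) =
          2 * ((a (π 0)).val + (a (π 2)).val + (a (π 4)).val + (a (π 6)).val + (a (π 8)).val)
        rw [← e0, ← e2, ← e4, ← e6, ← e8]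
        ring
      omega
    · intro i
      fin_cases i
      · rfl
      · exact e0.symm
      · rfl
      · exact e2.symm
      · rfl
      · exact e4.symm
      · rfl
      · exact e6.symm
      · rfl
      · exact e8.symm
  · rintro ⟨b, hb, hv⟩
    refine ⟨v ∘ π.symm, ?_, ?_⟩
    · change r7 (v ∘ π.symm) ∈ C
      rw [r7_eq]
      have hsum : ∑ j : Fin 5, b j • pr (π ⟨2 * j.val, by omega⟩) (π (tau ⟨2 * j.val, by omega⟩))
          ∈ D := Submodule.sum_mem _ fun j _ => D.smul_mem _ (hπ _)
      have e : ∑ j : Fin 5, b j • pr (π ⟨2 * j.val, by omega⟩) (π (tau ⟨2 * j.val, by omega⟩))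
          = (v ∘ π.symm, 0, 0) := by
        ext1
        · funext k
          obtain ⟨i, rfl⟩ := π.surjective k
          simp only [Prod.fst_sum, Finset.sum_apply, Prod.smul_fst, Pi.smul_apply, pr,
            Pi.add_apply, Pi.single_apply, EmbeddingLike.apply_eq_iff_eq, Function.comp_apply,
            Equiv.symm_apply_apply, hv, smul_eq_mul]
          simp [coef]
        · ext1
          · simpa [Prod.snd_sum, Prod.fst_sum, pr] using hb
          · simpa [Prod.snd_sum, pr] using hb
      rw [e] at hsum
      exact hsum
    · funext i
      simp
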